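/- arXiv:0902.3738 — 7 statements merged into one kernel-verified Lean document; each statement's English description precedes it below -/
import Mathlib

section
/- The Cayley 4-form Ω on ℍ ⊕ ℍ is invariant under the group K: for all unit quaternions q₊, q₋, q₀ and all u₁, u₂, u₃, u₄ ∈ ℍ ⊕ ℍ, Ω(κu₁, κu₂, κu₃, κu₄) = Ω(u₁, u₂, u₃, u₄), where κ = κ(q₊,q₋,q₀). -/
noncomputable section

abbrev H := Quaternion ℝ

def qi : H := ⟨0,1,0,0⟩
def qj : H := ⟨0,0,1,0⟩
def qk : H := ⟨0,0,0,1⟩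

def e : Fin 4 → H := ![1, qi, qj, qk]

def f : Fin 8 → H × H := ![(1,0),(qi,0),(qj,0),(qk,0),(0,1),(0,qi),(0,qj),(0,qk)]

def kappa (qp qm q0 : H) (u : H × H) : H × H :=
  (qp * u.1 * star qm, qp * u.2 * star q0)

def IsUnitQ (q : H) : Prop := ‖q‖ = 1

def innerHH (u v : H × H) : ℝ := (u.1 * star v.1).re + (u.2 * star v.2).re

def Om (u : Fin 4 → H × H) : ℝ :=
  -(1/24) * ∑ σ : Equiv.Perm (Fin 4), ((Equiv.Perm.sign σ : ℤ) : ℝ) *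
    ((u (σ 0)).1 * star ((u (σ 1)).1) * (u (σ 2)).1 * star ((u (σ 3)).1)
      - 6 * ((u (σ 0)).1 * star ((u (σ 1)).1) * (u (σ 2)).2 * star ((u (σ 3)).2))
      + (u (σ 0)).2 * star ((u (σ 1)).2) * (u (σ 2)).2 * star ((u (σ 3)).2)).re

def alphaF (u v : H × H) : H :=
  (u.1 * star v.1 - v.1 * star u.1) - (u.2 * star v.2 - v.2 * star u.2)

def betaF (u v : H × H) : H := star u.1 * v.2 - star v.1 * u.2

def omegaF : Fin 7 → (H × H) → (H × H) → ℝ :=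
  ![fun u v => (alphaF u v).imI,
    fun u v => (alphaF u v).imJ,
    fun u v => (alphaF u v).imK,
    fun u v => (betaF u v).re,
    fun u v => (betaF u v).imI,
    fun u v => (betaF u v).imJ,
    fun u v => (betaF u v).imK]

def formInner (a b : (H × H) → (H × H) → ℝ) : ℝ :=
  ∑ p : Fin 8, ∑ q ∈ Finset.Ioi p, a (f p) (f q) * b (f p) (f q)

def IsAlt2 (τ : (H × H) → (H × H) → ℝ) : Prop :=
  (∀ u, IsLinearMap ℝ (τ u)) ∧ (∀ v, IsLinearMap ℝ fun u => τ u v) ∧ ∀ u, τ u u = 0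

def wedge422 (A4 : (Fin 4 → H × H) → ℝ) (a b : (H × H) → (H × H) → ℝ) : ℝ :=
  ∑ σ ∈ Finset.univ.filter (fun σ : Equiv.Perm (Fin 8) =>
      σ 0 < σ 1 ∧ σ 1 < σ 2 ∧ σ 2 < σ 3 ∧ σ 4 < σ 5 ∧ σ 6 < σ 7),
    ((Equiv.Perm.sign σ : ℤ) : ℝ) * A4 ![f (σ 0), f (σ 1), f (σ 2), f (σ 3)]
      * a (f (σ 4)) (f (σ 5)) * b (f (σ 6)) (f (σ 7))

def coordM (x : Fin 4 → H) : Matrix (Fin 4) (Fin 4) ℝ :=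
  Matrix.of fun m => ![(x m).re, (x m).imI, (x m).imJ, (x m).imK]

theorem re_mul_comm_H (a b : H) : (a * b).re = (b * a).re := by
  simp only [Quaternion.re_mul]
  ring

theorem IsUnitQ.star_mul_self {q : H} (hq : IsUnitQ q) : star q * q = 1 := by
  rw [Quaternion.star_mul_self, Quaternion.normSq_eq_norm_mul_self, show ‖q‖ = 1 from hq]
  simp

theorem IsUnitQ.re_conj {q : H} (hq : IsUnitQ q) (w : H) : (q * w * star q).re = w.re := by
  rw [re_mul_comm_H, ← mul_assoc, hq.star_mul_self, one_mul]

/-- The twisted product `x * star y` only sees the common left factor. -/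
theorem IsUnitQ.mul_star_twist {r : H} (hr : IsUnitQ r) (q x y : H) :
    q * x * star r * star (q * y * star r) = q * (x * star y) * star q := by
  simp only [star_mul, star_star, mul_assoc]
  rw [← mul_assoc (star r) r, hr.star_mul_self, one_mul]

theorem IsUnitQ.conj_mul_conj {q : H} (hq : IsUnitQ q) (a b : H) :
    q * a * star q * (q * b * star q) = q * (a * b) * star q := by
  simp only [mul_assoc]
  rw [← mul_assoc (star q) q, hq.star_mul_self, one_mul]

/-- Simultaneous twisting leaves the real part of `x₀ x̄₁ y₂ ȳ₃` unchanged, the two pairs being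
allowed different right factors. -/
theorem re_quadruple_twist {q r s : H} (hq : IsUnitQ q) (hr : IsUnitQ r) (hs : IsUnitQ s)
    (a b c d : H) :
    (q * a * star r * star (q * b * star r) * (q * c * star s) * star (q * d * star s)).re =
      (a * star b * c * star d).re := by
  rw [mul_assoc, hr.mul_star_twist, hs.mul_star_twist, hq.conj_mul_conj, hq.re_conj, ← mul_assoc]

theorem re_six_mul (w : H) : ((6 : H) * w).re = 6 * w.re := by
  have h : (6 : H) = ((6 : ℝ) : H) := by norm_cast
  rw [h, Quaternion.coe_mul_eq_smul, Quaternion.re_smul, smul_eq_mul]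

/-- the Cayley 4-form Ω on ℍ ⊕ ℍ is invariant under the group K. -/
theorem stmt2 : ∀ qp qm q0 : H, IsUnitQ qp → IsUnitQ qm → IsUnitQ q0 →
    ∀ u : Fin 4 → H × H, Om (fun m => kappa qp qm q0 (u m)) = Om u := by
  intro qp qm q0 hp hm h0 u
  simp only [Om, kappa, Quaternion.re_add, Quaternion.re_sub, re_six_mul,
    re_quadruple_twist hp hm hm, re_quadruple_twist hp hm h0, re_quadruple_twist hp h0 h0]
end
end

section
/- The restriction of the Cayley 4-form Ω to each factor of ℍ ⊕ ℍ equals the determinant (volume) form: for all x₁, x₂, x₃, x₄ ∈ ℍ, Ω((x₁,0),(x₂,0),(x₃,0),(x₄,0)) equals the determinant of the 4×4 real matrix of coordinates of x₁, x₂, x₃, x₄ with respect to the basis (1,i,j,k), and likewise Ω((0,y₁),(0,y₂),(0,y₃),(0,y₄)) equals the determinant of the coordinate matrix of y₁, y₂, y₃, y₄. In particular Ω takes the value 1 on the quadruples ((1,0),(i,0),(j,0),(k,0)) and ((0,1),(0,i),(0,j),(0,k)). -/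
noncomputable section

/-- A function on `Perm α` invariant under right multiplication by a transposition has
vanishing signed sum. -/
theorem sum_sign_mul_eq_zero_of_swap {α : Type*} [Fintype α] [DecidableEq α]
    (g : Equiv.Perm α → ℝ) {i j : α} (hij : i ≠ j) (hg : ∀ σ, g (σ * Equiv.swap i j) = g σ) :
    ∑ σ : Equiv.Perm α, ((Equiv.Perm.sign σ : ℤ) : ℝ) * g σ = 0 := by
  have h := Equiv.sum_comp (Equiv.mulRight (Equiv.swap i j))
    fun σ : Equiv.Perm α => ((Equiv.Perm.sign σ : ℤ) : ℝ) * g σ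
  simp only [Equiv.coe_mulRight, hg, Equiv.Perm.sign_mul, Equiv.Perm.sign_swap hij, mul_neg,
    mul_one, Units.val_neg, Int.cast_neg, neg_mul, Finset.sum_neg_distrib] at h
  linarith

theorem coordM_comp_perm_det (x : Fin 4 → H) (σ : Equiv.Perm (Fin 4)) :
    (coordM (x ∘ σ)).det = ((Equiv.Perm.sign σ : ℤ) : ℝ) * (coordM x).det :=
  Matrix.det_permute σ (coordM x)

/-- The real part of `a * b̄ * c * d̄` in terms of real inner products and the volume form. -/
theorem re_mul_star_mul_mul_star (x : Fin 4 → H) :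
    (x 0 * star (x 1) * x 2 * star (x 3)).re =
      (x 0 * star (x 1)).re * (x 2 * star (x 3)).re
        - (x 0 * star (x 2)).re * (x 1 * star (x 3)).re
        + (x 0 * star (x 3)).re * (x 1 * star (x 2)).re - (coordM x).det := by
  simp [coordM, Matrix.det_succ_row_zero, Fin.sum_univ_succ, Fin.succAbove, Quaternion.re_mul,
    Quaternion.imI_mul, Quaternion.imJ_mul, Quaternion.imK_mul]
  ring

theorem re_mul_star_comm (a b : H) : (a * star b).re = (b * star a).re := by
  simp only [Quaternion.re_mul, Quaternion.re_star, Quaternion.imI_star, Quaternion.imJ_star,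
    Quaternion.imK_star]
  ring

/-- The signed sum of `Re (x₀ x̄₁ x₂ x̄₃)` is `-4!` times the volume form. -/
theorem sum_sign_mul_re (x : Fin 4 → H) :
    ∑ σ : Equiv.Perm (Fin 4), ((Equiv.Perm.sign σ : ℤ) : ℝ) *
      (x (σ 0) * star (x (σ 1)) * x (σ 2) * star (x (σ 3))).re = -24 * (coordM x).det := by
  have h (σ : Equiv.Perm (Fin 4)) := re_mul_star_mul_mul_star (x ∘ σ)
  simp only [Function.comp_apply, coordM_comp_perm_det] at h
  simp only [h, mul_sub, mul_add, Finset.sum_sub_distrib, Finset.sum_add_distrib]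
  rw [sum_sign_mul_eq_zero_of_swap _ (i := 0) (j := 1) (by decide),
    sum_sign_mul_eq_zero_of_swap _ (i := 0) (j := 2) (by decide),
    sum_sign_mul_eq_zero_of_swap _ (i := 0) (j := 3) (by decide)]
  · simp [← mul_assoc, ← Int.cast_mul, Fintype.card_perm, Nat.factorial]
  all_goals
    intro σ
    simp only [Equiv.Perm.mul_apply, Equiv.swap_apply_left, Equiv.swap_apply_right,
      Equiv.swap_apply_of_ne_of_ne (show (1 : Fin 4) ≠ 0 by decide) (show (1 : Fin 4) ≠ 2 by decide),
      Equiv.swap_apply_of_ne_of_ne (show (1 : Fin 4) ≠ 0 by decide) (show (1 : Fin 4) ≠ 3 by decide),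
      Equiv.swap_apply_of_ne_of_ne (show (2 : Fin 4) ≠ 0 by decide) (show (2 : Fin 4) ≠ 1 by decide),
      Equiv.swap_apply_of_ne_of_ne (show (2 : Fin 4) ≠ 0 by decide) (show (2 : Fin 4) ≠ 3 by decide),
      Equiv.swap_apply_of_ne_of_ne (show (3 : Fin 4) ≠ 0 by decide) (show (3 : Fin 4) ≠ 1 by decide),
      Equiv.swap_apply_of_ne_of_ne (show (3 : Fin 4) ≠ 0 by decide) (show (3 : Fin 4) ≠ 2 by decide)]
    rw [re_mul_star_comm]

theorem Om_fst (x : Fin 4 → H) : Om (fun m => (x m, 0)) = (coordM x).det := by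
  simp only [Om, mul_zero, star_zero, sub_zero, add_zero, sum_sign_mul_re]
  ring

theorem Om_snd (y : Fin 4 → H) : Om (fun m => (0, y m)) = (coordM y).det := by
  simp only [Om, zero_mul, mul_zero, star_zero, sub_zero, zero_add, sum_sign_mul_re]
  ring

theorem coordM_e_det : (coordM e).det = 1 := by
  have h : coordM e = 1 := by
    ext i j
    fin_cases i <;> fin_cases j <;> simp [coordM, e, qi, qj, qk] <;> rfl
  rw [h, Matrix.det_one]

/-- the restriction of Ω to each factor of ℍ ⊕ ℍ is the determinant
(volume) form; in particular Ω = 1 on the standard quaternionic bases of each factor. -/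
theorem stmt3 :
    (∀ x : Fin 4 → H, Om (fun m => (x m, 0)) = (coordM x).det) ∧
    (∀ y : Fin 4 → H, Om (fun m => (0, y m)) = (coordM y).det) ∧
    Om ![(1,0),(qi,0),(qj,0),(qk,0)] = 1 ∧
    Om ![(0,1),(0,qi),(0,qj),(0,qk)] = 1 := by
  refine ⟨Om_fst, Om_snd, ?_, ?_⟩
  · rw [← coordM_e_det, ← Om_fst]
    congr 1
    ext1 m
    fin_cases m <;> rfl
  · rw [← coordM_e_det, ← Om_snd]
    congr 1
    ext1 m
    fin_cases m <;> rfl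
end
end

section
/- The seven 2-forms ω₁, …, ω₇ on ℍ ⊕ ℍ are pairwise orthogonal and nonzero with respect to the inner product ⟨·,·⟩; in particular they are linearly independent and span a 7-dimensional subspace of the 28-dimensional space of alternating 2-forms on ℍ ⊕ ℍ. -/
noncomputable section

theorem formInner_sum_smul_left {ι : Type*} (s : Finset ι) (c : ι → ℝ)
    (a : ι → (H × H) → (H × H) → ℝ) (b : (H × H) → (H × H) → ℝ) :
    formInner (∑ i ∈ s, c i • a i) b = ∑ i ∈ s, c i * formInner (a i) b := by
  simp only [formInner, Finset.sum_apply, Pi.smul_apply, smul_eq_mul, Finset.sum_mul,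
    Finset.mul_sum, mul_assoc]
  rw [Finset.sum_comm]
  rw [Finset.sum_congr rfl fun p _ => Finset.sum_comm]

/-- A family of forms that is orthogonal for `formInner`, with nonzero squared norms, is linearly
independent. -/
theorem linearIndependent_of_formInner_orthogonal {ι : Type*}
    {a : ι → (H × H) → (H × H) → ℝ} (horth : ∀ i j, i ≠ j → formInner (a i) (a j) = 0)
    (hne : ∀ i, formInner (a i) (a i) ≠ 0) : LinearIndependent ℝ a := by
  rw [linearIndependent_iff']
  intro s c hc j hj
  have h := formInner_sum_smul_left s c a (a j)
  rw [hc, Finset.sum_eq_single_of_mem j hj fun i _ hij => by rw [horth i j hij, mul_zero]] at h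
  have h0 : formInner 0 (a j) = 0 := by simp [formInner]
  exact (mul_eq_zero.mp (h.symm.trans h0)).resolve_right (hne j)

/-- The vector of `ℍ ⊕ ℍ` with the given integer coordinates in the basis `f`. -/
def ofCoords (a : Fin 8 → ℤ) : H × H :=
  (⟨a 0, a 1, a 2, a 3⟩, ⟨a 4, a 5, a 6, a 7⟩)

@[simp] theorem ofCoords_fst_re (a : Fin 8 → ℤ) : (ofCoords a).1.re = a 0 := rfl

@[simp] theorem ofCoords_fst_imI (a : Fin 8 → ℤ) : (ofCoords a).1.imI = a 1 := rfl

@[simp] theorem ofCoords_fst_imJ (a : Fin 8 → ℤ) : (ofCoords a).1.imJ = a 2 := rfl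

@[simp] theorem ofCoords_fst_imK (a : Fin 8 → ℤ) : (ofCoords a).1.imK = a 3 := rfl

@[simp] theorem ofCoords_snd_re (a : Fin 8 → ℤ) : (ofCoords a).2.re = a 4 := rfl

@[simp] theorem ofCoords_snd_imI (a : Fin 8 → ℤ) : (ofCoords a).2.imI = a 5 := rfl

@[simp] theorem ofCoords_snd_imJ (a : Fin 8 → ℤ) : (ofCoords a).2.imJ = a 6 := rfl

@[simp] theorem ofCoords_snd_imK (a : Fin 8 → ℤ) : (ofCoords a).2.imK = a 7 := rfl

/-- The values of the seven forms on vectors with integer coordinates. -/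
def omegaCoords (i : Fin 7) (a b : Fin 8 → ℤ) : ℤ :=
  let E (p q : Fin 8) : ℤ := a p * b q - a q * b p
  match i with
  | 0 => -2 * (E 0 1 + E 2 3) + 2 * (E 4 5 + E 6 7)
  | 1 => -2 * (E 0 2 - E 1 3) + 2 * (E 4 6 - E 5 7)
  | 2 => -2 * (E 0 3 + E 1 2) + 2 * (E 4 7 + E 5 6)
  | 3 => E 0 4 + E 1 5 + E 2 6 + E 3 7
  | 4 => E 0 5 - E 1 4 - E 2 7 + E 3 6
  | 5 => E 0 6 + E 1 7 - E 2 4 - E 3 5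
  | 6 => E 0 7 - E 1 6 + E 2 5 - E 3 4

open scoped Quaternion in
theorem ofCoords_single (p : Fin 8) : ofCoords (Pi.single p 1) = f p := by
  fin_cases p <;> ext <;> simp [ofCoords, f, qi, qj, qk]

open scoped Quaternion in
theorem alphaF_ofCoords (a b : Fin 8 → ℤ) :
    alphaF (ofCoords a) (ofCoords b) =
      ⟨0, omegaCoords 0 a b, omegaCoords 1 a b, omegaCoords 2 a b⟩ := by
  ext <;> simp [alphaF, omegaCoords] <;> ring

open scoped Quaternion in
theorem betaF_ofCoords (a b : Fin 8 → ℤ) :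
    betaF (ofCoords a) (ofCoords b) =
      ⟨omegaCoords 3 a b, omegaCoords 4 a b, omegaCoords 5 a b, omegaCoords 6 a b⟩ := by
  ext <;> simp [betaF, omegaCoords] <;> ring

theorem omegaF_ofCoords (i : Fin 7) (a b : Fin 8 → ℤ) :
    omegaF i (ofCoords a) (ofCoords b) = omegaCoords i a b := by
  have hα := alphaF_ofCoords a b
  have hβ := betaF_ofCoords a b
  match i with
  | 0 => exact congrArg (·.imI) hα
  | 1 => exact congrArg (·.imJ) hα
  | 2 => exact congrArg (·.imK) hα
  | 3 => exact congrArg (·.re) hβ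
  | 4 => exact congrArg (·.imI) hβ
  | 5 => exact congrArg (·.imJ) hβ
  | 6 => exact congrArg (·.imK) hβ

/-- The Gram matrix of the seven forms. -/
theorem formInner_omegaF (i j : Fin 7) :
    formInner (omegaF i) (omegaF j) = if i = j then (if i < 3 then 16 else 4) else 0 := by
  have h : ∀ i j : Fin 7, ∑ p : Fin 8, ∑ q ∈ Finset.Ioi p,
      omegaCoords i (Pi.single p 1) (Pi.single q 1) *
        omegaCoords j (Pi.single p 1) (Pi.single q 1) =
        if i = j then (if i < 3 then 16 else 4) else 0 := by
    decide +kernel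
  simp only [formInner, ← ofCoords_single, omegaF_ofCoords]
  exact_mod_cast congrArg (Int.cast (R := ℝ)) (h i j)

/-- the seven 2-forms ω₁,…,ω₇ are pairwise orthogonal and nonzero;
in particular they are linearly independent and span a 7-dimensional subspace. -/
theorem stmt6 :
    (∀ i j : Fin 7, i ≠ j → formInner (omegaF i) (omegaF j) = 0) ∧
    (∀ i : Fin 7, formInner (omegaF i) (omegaF i) ≠ 0) ∧
    LinearIndependent ℝ omegaF ∧
    Module.finrank ℝ ↥(Submodule.span ℝ (Set.range omegaF)) = 7 := by
  have horth : ∀ i j : Fin 7, i ≠ j → formInner (omegaF i) (omegaF j) = 0 := fun i j hij => by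
    rw [formInner_omegaF, if_neg hij]
  have hne : ∀ i : Fin 7, formInner (omegaF i) (omegaF i) ≠ 0 := fun i => by
    rw [formInner_omegaF, if_pos rfl]
    split_ifs <;> norm_num
  have hli := linearIndependent_of_formInner_orthogonal horth hne
  exact ⟨horth, hne, hli, by rw [finrank_span_eq_card hli, Fintype.card_fin]⟩
end
end

section
/- Each of the seven 2-forms ω₁, …, ω₇ is an eigenvector with eigenvalue 3 of the operator ω ↦ ∗(Ω ∧ ω) on 2-forms: for each i ∈ {1,…,7} and every alternating 2-form τ on ℍ ⊕ ℍ, (Ω ∧ ω_i ∧ τ)(f₀, f₁, …, f₇) = 3 ⟨ω_i, τ⟩. -/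
noncomputable section

/-- The componentwise embedding of the integral quaternions into the real ones. -/
def quaternionCast (q : Quaternion ℤ) : H := ⟨q.re, q.imI, q.imJ, q.imK⟩

@[simp] lemma quaternionCast_re (q : Quaternion ℤ) : (quaternionCast q).re = q.re := rfl

@[simp] lemma quaternionCast_imI (q : Quaternion ℤ) : (quaternionCast q).imI = q.imI := rfl

@[simp] lemma quaternionCast_imJ (q : Quaternion ℤ) : (quaternionCast q).imJ = q.imJ := rfl

@[simp] lemma quaternionCast_imK (q : Quaternion ℤ) : (quaternionCast q).imK = q.imK := rfl

lemma quaternionCast_mul (p q : Quaternion ℤ) :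
    quaternionCast (p * q) = quaternionCast p * quaternionCast q := by
  ext <;> simp

lemma quaternionCast_add (p q : Quaternion ℤ) :
    quaternionCast (p + q) = quaternionCast p + quaternionCast q := by
  ext <;> simp

lemma quaternionCast_sub (p q : Quaternion ℤ) :
    quaternionCast (p - q) = quaternionCast p - quaternionCast q := by
  ext <;> simp

lemma quaternionCast_star (p : Quaternion ℤ) :
    quaternionCast (star p) = star (quaternionCast p) := by
  ext <;> simp

lemma quaternionCast_six : quaternionCast 6 = 6 :=
  Quaternion.ext _ _ (Int.cast_ofNat 6) Int.cast_zero Int.cast_zero Int.cast_zero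

/-- The basis `f`, with integral coordinates. -/
def intBasis : Fin 8 → Quaternion ℤ × Quaternion ℤ :=
  ![(⟨1, 0, 0, 0⟩, 0), (⟨0, 1, 0, 0⟩, 0), (⟨0, 0, 1, 0⟩, 0), (⟨0, 0, 0, 1⟩, 0),
    (0, ⟨1, 0, 0, 0⟩), (0, ⟨0, 1, 0, 0⟩), (0, ⟨0, 0, 1, 0⟩), (0, ⟨0, 0, 0, 1⟩)]

open scoped Quaternion in
lemma f_eq_cast_intBasis (a : Fin 8) :
    f a = (quaternionCast (intBasis a).1, quaternionCast (intBasis a).2) := by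
  fin_cases a <;> ext <;> simp [f, intBasis, quaternionCast, qi, qj, qk]

/-- The sign of a sequence, as the parity of its number of inversions. -/
def inversionSign {n : ℕ} (w : Fin n → Fin n) : ℤ :=
  ∏ i, ∏ j, if i < j then if w i < w j then 1 else -1 else 1

lemma sign_eq_inversionSign {n : ℕ} (σ : Equiv.Perm (Fin n)) :
    (Equiv.Perm.sign σ : ℤ) = inversionSign σ := by
  rw [σ.sign_eq_prod_prod_Ioi, inversionSign]
  push_cast
  refine Finset.prod_congr rfl fun i _ => ?_
  rw [← Finset.prod_filter, Finset.filter_lt_eq_Ioi]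
  refine Finset.prod_congr rfl fun j _ => ?_
  split_ifs <;> rfl

/-- The values of `-24 • Om` on basis vectors. -/
def intOm (u : Fin 4 → Fin 8) : ℤ :=
  ∑ σ : Equiv.Perm (Fin 4), inversionSign σ *
    (((intBasis (u (σ 0))).1 * star (intBasis (u (σ 1))).1) *
        ((intBasis (u (σ 2))).1 * star (intBasis (u (σ 3))).1)
      - 6 * (((intBasis (u (σ 0))).1 * star (intBasis (u (σ 1))).1) *
        ((intBasis (u (σ 2))).2 * star (intBasis (u (σ 3))).2))
      + ((intBasis (u (σ 0))).2 * star (intBasis (u (σ 1))).2) *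
        ((intBasis (u (σ 2))).2 * star (intBasis (u (σ 3))).2)).re

lemma Om_comp_f (u : Fin 4 → Fin 8) : Om (f ∘ u) = -(1 / 24) * (intOm u : ℝ) := by
  have hre : ∀ q : Quaternion ℤ, ((q.re : ℤ) : ℝ) = (quaternionCast q).re := fun _ => rfl
  simp only [Om, intOm, ← sign_eq_inversionSign, Int.cast_sum, Int.cast_mul, hre,
    quaternionCast_add, quaternionCast_sub, quaternionCast_mul, quaternionCast_star,
    quaternionCast_six, f_eq_cast_intBasis, Function.comp_apply, mul_assoc]

/-- The coefficient of `Om` at an increasing quadruple of basis vectors. -/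
def omCoeff (a b c d : Fin 8) : ℤ :=
  if (a, b, c, d) ∈ [((0, 1, 2, 3) : Fin 8 × Fin 8 × Fin 8 × Fin 8),
    (0, 2, 5, 7), (1, 3, 4, 6), (4, 5, 6, 7)] then 1
  else if (a, b, c, d) ∈ [((0, 1, 4, 5) : Fin 8 × Fin 8 × Fin 8 × Fin 8), (0, 1, 6, 7),
    (0, 2, 4, 6), (0, 3, 4, 7), (0, 3, 5, 6), (1, 2, 4, 7), (1, 2, 5, 6), (1, 3, 5, 7),
    (2, 3, 4, 5), (2, 3, 6, 7)] then -1
  else 0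

lemma intOm_eq_omCoeff : ∀ a b c d : Fin 8, a < b → b < c → c < d →
    intOm ![a, b, c, d] = -24 * omCoeff a b c d := by
  decide +kernel

lemma Om_f {a b c d : Fin 8} (hab : a < b) (hbc : b < c) (hcd : c < d) :
    Om ![f a, f b, f c, f d] = omCoeff a b c d := by
  have h : ![f a, f b, f c, f d] = f ∘ ![a, b, c, d] := by
    ext i <;> fin_cases i <;> rfl
  rw [h, Om_comp_f, intOm_eq_omCoeff a b c d hab hbc hcd]
  push_cast
  ring

/-- The values of `omegaF` on basis vectors. -/
def intOmega (i : Fin 7) (a b : Fin 8) : ℤ :=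
  let u := intBasis a
  let v := intBasis b
  let α := (u.1 * star v.1 - v.1 * star u.1) - (u.2 * star v.2 - v.2 * star u.2)
  let β := star u.1 * v.2 - star v.1 * u.2
  ![α.imI, α.imJ, α.imK, β.re, β.imI, β.imJ, β.imK] i

lemma omegaF_f (i : Fin 7) (a b : Fin 8) : omegaF i (f a) (f b) = intOmega i a b := by
  have hα : alphaF (f a) (f b) = quaternionCast
      (((intBasis a).1 * star (intBasis b).1 - (intBasis b).1 * star (intBasis a).1) -
        ((intBasis a).2 * star (intBasis b).2 - (intBasis b).2 * star (intBasis a).2)) := by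
    simp only [alphaF, f_eq_cast_intBasis, quaternionCast_sub, quaternionCast_mul,
      quaternionCast_star]
  have hβ : betaF (f a) (f b) = quaternionCast
      (star (intBasis a).1 * (intBasis b).2 - star (intBasis b).1 * (intBasis a).2) := by
    simp only [betaF, f_eq_cast_intBasis, quaternionCast_sub, quaternionCast_mul,
      quaternionCast_star]
  fin_cases i
  · exact congrArg (·.imI) hα
  · exact congrArg (·.imJ) hα
  · exact congrArg (·.imK) hα
  · exact congrArg (·.re) hβ
  · exact congrArg (·.imI) hβ
  · exact congrArg (·.imJ) hβ
  · exact congrArg (·.imK) hβ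

/-- The sequence ending in `a, b, c, d` and starting with the other indices in increasing order. -/
def shuffle (a b c d : Fin 8) (i : Fin 8) : Fin 8 :=
  ((List.finRange 8).filter (· ∉ [a, b, c, d]) ++ [a, b, c, d]).getD i 0

lemma shuffle_spec : ∀ c d a b : Fin 8, c < d → a < b → a ≠ c → a ≠ d → b ≠ c → b ≠ d →
    (∀ i j, shuffle a b c d i = shuffle a b c d j → i = j) ∧
    shuffle a b c d 0 < shuffle a b c d 1 ∧ shuffle a b c d 1 < shuffle a b c d 2 ∧
    shuffle a b c d 2 < shuffle a b c d 3 ∧ shuffle a b c d 4 = a ∧ shuffle a b c d 5 = b ∧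
    shuffle a b c d 6 = c ∧ shuffle a b c d 7 = d := by
  decide +kernel

lemma shuffle_apply_perm (σ : Equiv.Perm (Fin 8)) (h01 : σ 0 < σ 1) (h12 : σ 1 < σ 2)
    (h23 : σ 2 < σ 3) : shuffle (σ 4) (σ 5) (σ 6) (σ 7) = σ := by
  have key : (List.finRange 8).filter (· ∉ [σ 4, σ 5, σ 6, σ 7]) = [σ 0, σ 1, σ 2, σ 3] := by
    apply List.Pairwise.eq_of_mem_iff (r := (· < ·))
    · exact List.Pairwise.filter _ (List.pairwise_lt_finRange 8)
    · simp [h01, h12, h23, h01.trans h12, h12.trans h23, (h01.trans h12).trans h23]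
    · intro x
      obtain ⟨y, rfl⟩ := σ.surjective x
      simp only [List.mem_filter, List.mem_finRange, true_and, List.mem_cons, List.not_mem_nil,
        or_false, decide_eq_true_eq, σ.injective.eq_iff]
      revert y
      decide
  funext i
  unfold shuffle
  rw [key]
  fin_cases i <;> rfl

/-- The contribution to `wedge422 Om (omegaF i) τ` of the shuffle ending in `a, b, c, d`,
divided by the value of `τ`. -/
def shuffleCoeff (i : Fin 7) (c d a b : Fin 8) : ℤ :=
  if a < b ∧ a ≠ c ∧ a ≠ d ∧ b ≠ c ∧ b ≠ d then
    inversionSign (shuffle a b c d) *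
      omCoeff (shuffle a b c d 0) (shuffle a b c d 1) (shuffle a b c d 2) (shuffle a b c d 3) *
      intOmega i a b
  else 0

lemma sum_shuffleCoeff : ∀ (i : Fin 7) (c d : Fin 8), c < d →
    ∑ a, ∑ b, shuffleCoeff i c d a b = 3 * intOmega i c d := by
  decide +kernel

lemma wedge422_Om_omegaF (i : Fin 7) (τ : (H × H) → (H × H) → ℝ) :
    wedge422 Om (omegaF i) τ =
      ∑ c, ∑ d ∈ Finset.Ioi c, (∑ a, ∑ b, (shuffleCoeff i c d a b : ℝ)) * τ (f c) (f d) := by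
  classical
  let S : Finset (Fin 8 × Fin 8 × Fin 8 × Fin 8) := {q | q.1 < q.2.1 ∧ q.2.2.1 < q.2.2.2 ∧
    q.2.2.1 ≠ q.1 ∧ q.2.2.1 ≠ q.2.1 ∧ q.2.2.2 ≠ q.1 ∧ q.2.2.2 ≠ q.2.1}
  have hR : ∑ c, ∑ d ∈ Finset.Ioi c, (∑ a, ∑ b, (shuffleCoeff i c d a b : ℝ)) * τ (f c) (f d) =
      ∑ q ∈ S, (shuffleCoeff i q.1 q.2.1 q.2.2.1 q.2.2.2 : ℝ) * τ (f q.1) (f q.2.1) := by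
    simp only [S, Finset.sum_filter, Fintype.sum_prod_type]
    refine Finset.sum_congr rfl fun c _ => ?_
    rw [← Finset.filter_lt_eq_Ioi, Finset.sum_filter]
    refine Finset.sum_congr rfl fun d _ => ?_
    simp only [Finset.sum_mul]
    by_cases hcd : c < d
    · simp only [hcd, if_true, true_and]
      refine Finset.sum_congr rfl fun a _ => Finset.sum_congr rfl fun b _ => ?_
      split_ifs with h
      · rfl
      · simp [shuffleCoeff, h]
    · simp [hcd]
  rw [hR, wedge422]
  refine Finset.sum_bij (fun σ _ => (σ 6, σ 7, σ 4, σ 5)) ?_ ?_ ?_ ?_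
  · intro σ hσ
    obtain ⟨-, -, -, -, h45, h67⟩ := Finset.mem_filter.1 hσ
    simp [S, h45, h67, σ.injective.eq_iff]
  · intro σ hσ ρ hρ h
    obtain ⟨-, h01, h12, h23, -, -⟩ := Finset.mem_filter.1 hσ
    obtain ⟨-, k01, k12, k23, -, -⟩ := Finset.mem_filter.1 hρ
    simp only [Prod.mk.injEq] at h
    apply DFunLike.coe_injective
    rw [← shuffle_apply_perm σ h01 h12 h23, ← shuffle_apply_perm ρ k01 k12 k23, h.1, h.2.1,
      h.2.2.1, h.2.2.2]
  · rintro ⟨c, d, a, b⟩ hq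
    obtain ⟨-, hcd, hab, hac, had, hbc, hbd⟩ := Finset.mem_filter.1 hq
    obtain ⟨hinj, h01, h12, h23, h4, h5, h6, h7⟩ :=
      shuffle_spec c d a b hcd hab hac had hbc hbd
    refine ⟨Equiv.ofBijective (shuffle a b c d)
      (Finite.injective_iff_bijective.1 fun i j => hinj i j), ?_, ?_⟩
    · simp only [Finset.mem_filter, Finset.mem_univ, true_and, Equiv.ofBijective_apply, h4, h5,
        h6, h7]
      exact ⟨h01, h12, h23, hab, hcd⟩
    · simp only [Equiv.ofBijective_apply, h4, h5, h6, h7]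
  · intro σ hσ
    obtain ⟨-, h01, h12, h23, h45, h67⟩ := Finset.mem_filter.1 hσ
    have hc : shuffleCoeff i (σ 6) (σ 7) (σ 4) (σ 5) =
        Equiv.Perm.sign σ * omCoeff (σ 0) (σ 1) (σ 2) (σ 3) * intOmega i (σ 4) (σ 5) := by
      rw [shuffleCoeff, if_pos (by simp [h45, σ.injective.eq_iff]),
        shuffle_apply_perm σ h01 h12 h23, sign_eq_inversionSign]
    rw [hc, Om_f h01 h12 h23, omegaF_f]
    push_cast
    ring

/-- each ωᵢ is an eigenvector with eigenvalue 3 of ω ↦ ∗(Ω ∧ ω):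
(Ω ∧ ωᵢ ∧ τ)(f₀,…,f₇) = 3⟨ωᵢ,τ⟩ for every alternating 2-form τ. -/
theorem stmt7 : ∀ i : Fin 7, ∀ τ : (H × H) → (H × H) → ℝ, IsAlt2 τ →
    wedge422 Om (omegaF i) τ = 3 * formInner (omegaF i) τ := by
  intro i τ _
  rw [wedge422_Om_omegaF, formInner, Finset.mul_sum]
  refine Finset.sum_congr rfl fun c _ => ?_
  rw [Finset.mul_sum]
  refine Finset.sum_congr rfl fun d hd => ?_
  have h := congrArg (Int.cast : ℤ → ℝ) (sum_shuffleCoeff i c d (Finset.mem_Ioi.1 hd))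
  push_cast at h
  rw [h, omegaF_f, mul_assoc]
end
end

section
/- An alternating 2-form ω on ℍ ⊕ ℍ is Ω-anti-self-dual, i.e. ⟨ω, ω_i⟩ = 0 for all i = 1,…,7, if and only if both of the following quaternionic conditions hold: (i) Σ_{α,β=0}^{3} ω((e_α,0),(0,e_β)) · ē_α e_β = 0 in ℍ (vanishing of the Clifford contraction of the mixed component ω_{1,1}), and (ii) Σ_{α,β=0}^{3} ω((e_α,0),(e_β,0)) · e_α ē_β = Σ_{α,β=0}^{3} ω((0,e_α),(0,e_β)) · e_α ē_β in ℍ (equality of the self-dual parts of ω_{2,0} and ω_{0,2}). -/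
noncomputable section

theorem IsAlt2.map_swap {τ : (H × H) → (H × H) → ℝ} (hτ : IsAlt2 τ) (u v : H × H) :
    τ u v = -τ v u := by
  obtain ⟨hr, hl, halt⟩ := hτ
  have h := halt (u + v)
  rw [(hr (u + v)).map_add, (hl u).map_add, (hl v).map_add, halt u, halt v] at h
  linarith

theorem sum_Ioi_eq_sum_ite {n : ℕ} {M : Type*} [AddCommMonoid M] (p : Fin n) (g : Fin n → M) :
    ∑ q ∈ Finset.Ioi p, g q = ∑ q, if p < q then g q else 0 := by
  rw [← Finset.sum_filter, Finset.filter_lt_eq_Ioi]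

theorem formInner_eq_sum (a b : (H × H) → (H × H) → ℝ) :
    formInner a b =
      (∑ p : Fin 4, ∑ q ∈ Finset.Ioi p, a (e p, 0) (e q, 0) * b (e p, 0) (e q, 0))
        + (∑ p : Fin 4, ∑ q : Fin 4, a (e p, 0) (0, e q) * b (e p, 0) (0, e q))
        + ∑ p : Fin 4, ∑ q ∈ Finset.Ioi p, a (0, e p) (0, e q) * b (0, e p) (0, e q) := by
  simp only [formInner, sum_Ioi_eq_sum_ite, Fin.sum_univ_four, Fin.sum_univ_eight]
  simp [f, e]
  ring

theorem sum_smul_mul_star_eq_sum_Ioi {c : Fin 4 → Fin 4 → ℝ} (hc : ∀ p q, c p q = -c q p)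
    (x : Fin 4 → H) :
    ∑ p, ∑ q, c p q • (x p * star (x q))
      = ∑ p, ∑ q ∈ Finset.Ioi p, c p q • (x p * star (x q) - x q * star (x p)) := by
  have h0 : ∀ p, c p p = 0 := fun p => by linarith [hc p p]
  simp only [sum_Ioi_eq_sum_ite, Fin.sum_univ_four]
  simp [h0]
  rw [hc 1 0, hc 2 0, hc 2 1, hc 3 0, hc 3 1, hc 3 2]
  module

theorem formInner_alphaF {ω : (H × H) → (H × H) → ℝ} (hω : IsAlt2 ω) (l : H →ₗ[ℝ] ℝ) :
    formInner ω (fun u v => l (alphaF u v))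
      = l (∑ a, ∑ b, ω (e a, 0) (e b, 0) • (e a * star (e b)))
        - l (∑ a, ∑ b, ω (0, e a) (0, e b) • (e a * star (e b))) := by
  rw [sum_smul_mul_star_eq_sum_Ioi (fun _ _ => hω.map_swap _ _),
    sum_smul_mul_star_eq_sum_Ioi (fun _ _ => hω.map_swap _ _), formInner_eq_sum]
  simp [alphaF, mul_sub]
  ring

theorem formInner_betaF (ω : (H × H) → (H × H) → ℝ) (l : H →ₗ[ℝ] ℝ) :
    formInner ω (fun u v => l (betaF u v))
      = l (∑ a, ∑ b, ω (e a, 0) (0, e b) • (star (e a) * e b)) := by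
  rw [formInner_eq_sum]
  simp [betaF]

theorem re_sum_smul_mul_star {c : Fin 4 → Fin 4 → ℝ} (hc : ∀ p q, c p q = -c q p)
    (x : Fin 4 → H) : (∑ p, ∑ q, c p q • (x p * star (x q))).re = 0 := by
  rw [sum_smul_mul_star_eq_sum_Ioi hc]
  have h : ∀ y z : H, (y * star z - z * star y).re = 0 := fun y z => by
    simp; ring
  simp [sum_Ioi_eq_sum_ite, Fin.sum_univ_four, h]

/-- an alternating 2-form ω on ℍ ⊕ ℍ is Ω-anti-self-dual (orthogonal to
ω₁,…,ω₇) iff the Clifford contraction of its mixed component vanishes and the self-dual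
parts of its (2,0)- and (0,2)-components agree. -/
theorem stmt10 : ∀ ω : (H × H) → (H × H) → ℝ, IsAlt2 ω →
    ((∀ i : Fin 7, formInner ω (omegaF i) = 0) ↔
      ((∑ a : Fin 4, ∑ b : Fin 4, ω (e a, 0) (0, e b) • (star (e a) * e b)) = 0 ∧
        (∑ a : Fin 4, ∑ b : Fin 4, ω (e a, 0) (e b, 0) • (e a * star (e b)))
          = ∑ a : Fin 4, ∑ b : Fin 4, ω (0, e a) (0, e b) • (e a * star (e b)))) := by
  intro ω hω
  have hα := formInner_alphaF hω
  have hβ := formInner_betaF ω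
  have h20 := re_sum_smul_mul_star (fun p q => hω.map_swap (e p, 0) (e q, 0)) e
  have h02 := re_sum_smul_mul_star (fun p q => hω.map_swap (0, e p) (0, e q)) e
  generalize ∑ a, ∑ b, ω (e a, 0) (e b, 0) • (e a * star (e b)) = x at *
  generalize ∑ a, ∑ b, ω (0, e a) (0, e b) • (e a * star (e b)) = y at *
  generalize ∑ a, ∑ b, ω (e a, 0) (0, e b) • (star (e a) * e b) = z at *
  have h0 : formInner ω (omegaF 0) = x.imI - y.imI := hα (QuaternionAlgebra.imIₗ _ _ _)
  have h1 : formInner ω (omegaF 1) = x.imJ - y.imJ := hα (QuaternionAlgebra.imJₗ _ _ _)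
  have h2 : formInner ω (omegaF 2) = x.imK - y.imK := hα (QuaternionAlgebra.imKₗ _ _ _)
  have h3 : formInner ω (omegaF 3) = z.re := hβ (QuaternionAlgebra.reₗ _ _ _)
  have h4 : formInner ω (omegaF 4) = z.imI := hβ (QuaternionAlgebra.imIₗ _ _ _)
  have h5 : formInner ω (omegaF 5) = z.imJ := hβ (QuaternionAlgebra.imJₗ _ _ _)
  have h6 : formInner ω (omegaF 6) = z.imK := hβ (QuaternionAlgebra.imKₗ _ _ _)
  simp only [Fin.forall_fin_succ, Quaternion.ext_iff]
  simp [h0, h1, h2, h3, h4, h5, h6, h20, h02, sub_eq_zero]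
  tauto
end
end

section
/- For any alternating 2-form ω on ℍ ⊕ ℍ: −(ω ∧ ω ∧ Ω⁴⁰)(f₀,…,f₇) = |ω₀₂⁻|² − |ω₀₂⁺|² and (ω ∧ ω ∧ Ω⁰⁴)(f₀,…,f₇) = |ω₂₀⁺|² − |ω₂₀⁻|², where ω₀₂ is the 2-form on ℍ given by (y,y') ↦ ω((0,y),(0,y')), ω₂₀ is the 2-form (x,x') ↦ ω((x,0),(x',0)), and ± denote the self-dual and anti-self-dual parts. In particular −(ω ∧ ω ∧ Ω⁴⁰)(f₀,…,f₇) ≤ |ω|² and (ω ∧ ω ∧ Ω⁰⁴)(f₀,…,f₇) ≤ |ω|². -/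
noncomputable section

/-- Alternating ℝ-bilinear 2-forms on ℍ. -/
def IsAlt2H (τ : H → H → ℝ) : Prop :=
  (∀ u, IsLinearMap ℝ (τ u)) ∧ (∀ v, IsLinearMap ℝ fun u => τ u v) ∧ ∀ u, τ u u = 0

/-- The inner product ⟨α,β⟩ = Σ_{0≤a<b≤3} α(e_a,e_b)β(e_a,e_b) of 2-forms on ℍ. -/
def innerH2 (a b : H → H → ℝ) : ℝ :=
  ∑ p : Fin 4, ∑ q ∈ Finset.Ioi p, a (e p) (e q) * b (e p) (e q)

/-- The three self-dual 2-forms on ℍ: the i-, j-, k-components of (a,b) ↦ a b̄ − b ā. -/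
def sdH : Fin 3 → H → H → ℝ :=
  ![fun a b => (a * star b - b * star a).imI,
    fun a b => (a * star b - b * star a).imJ,
    fun a b => (a * star b - b * star a).imK]

/-- Orthogonal projection of a 2-form on ℍ onto the span of the self-dual forms. -/
def sdProj (τ : H → H → ℝ) : H → H → ℝ :=
  fun u v => ∑ c : Fin 3, (innerH2 τ (sdH c) / innerH2 (sdH c) (sdH c)) * sdH c u v

/-- Determinant 4-form Ω⁴⁰ in the first ℍ-factor. -/
def Om40 (u : Fin 4 → H × H) : ℝ := (coordM fun m => (u m).1).det

/-- Determinant 4-form Ω⁰⁴ in the second ℍ-factor. -/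
def Om04 (u : Fin 4 → H × H) : ℝ := (coordM fun m => (u m).2).det

/-- Shuffle-normalized wedge product (a ∧ b ∧ A4)(f₀,…,f₇) of two 2-forms and a 4-form. -/
def wedge224 (a b : (H × H) → (H × H) → ℝ) (A4 : (Fin 4 → H × H) → ℝ) : ℝ :=
  ∑ σ ∈ Finset.univ.filter (fun σ : Equiv.Perm (Fin 8) =>
      σ 0 < σ 1 ∧ σ 2 < σ 3 ∧ σ 4 < σ 5 ∧ σ 5 < σ 6 ∧ σ 6 < σ 7),
    ((Equiv.Perm.sign σ : ℤ) : ℝ) * a (f (σ 0)) (f (σ 1)) * b (f (σ 2)) (f (σ 3))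
      * A4 ![f (σ 4), f (σ 5), f (σ 6), f (σ 7)]

/-- The permutations of `Fin 8` that fix `4, …, 7` and restrict to a `(2,2)`-shuffle of
`0, …, 3`. -/
def shuffles22 : Finset (Equiv.Perm (Fin 8)) :=
  {1, Equiv.swap 1 2, Equiv.swap 1 3 * Equiv.swap 2 3, Equiv.swap 0 1 * Equiv.swap 1 2,
    Equiv.swap 0 1 * Equiv.swap 1 3 * Equiv.swap 3 2, Equiv.swap 0 2 * Equiv.swap 1 3}

theorem sum_shuffles22 (F : Equiv.Perm (Fin 8) → ℝ) :
    ∑ ρ ∈ shuffles22, F ρ = F 1 + F (Equiv.swap 1 2) + F (Equiv.swap 1 3 * Equiv.swap 2 3) +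
      F (Equiv.swap 0 1 * Equiv.swap 1 2) +
      F (Equiv.swap 0 1 * Equiv.swap 1 3 * Equiv.swap 3 2) +
      F (Equiv.swap 0 2 * Equiv.swap 1 3) := by
  unfold shuffles22
  rw [Finset.sum_insert (by decide), Finset.sum_insert (by decide),
    Finset.sum_insert (by decide), Finset.sum_insert (by decide),
    Finset.sum_insert (by decide), Finset.sum_singleton]
  ring

theorem mem_shuffles22 {ρ : Equiv.Perm (Fin 8)} (h : ∀ i, 4 ≤ i → ρ i = i)
    (h₀₁ : ρ 0 < ρ 1) (h₂₃ : ρ 2 < ρ 3) : ρ ∈ shuffles22 := by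
  have hlt : ∀ i < 4, ρ i < 4 := by
    intro i hi
    by_contra hc
    have := ρ.injective (h (ρ i) (not_lt.mp hc))
    rw [this] at hc
    exact hc hi
  have a₀ := hlt 0 (by decide)
  have a₁ := hlt 1 (by decide)
  have a₂ := hlt 2 (by decide)
  have a₃ := hlt 3 (by decide)
  have n₀₂ : ρ 0 ≠ ρ 2 := ρ.injective.ne (by decide)
  have n₀₃ : ρ 0 ≠ ρ 3 := ρ.injective.ne (by decide)
  have n₁₂ : ρ 1 ≠ ρ 2 := ρ.injective.ne (by decide)
  have n₁₃ : ρ 1 ≠ ρ 3 := ρ.injective.ne (by decide)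
  have key : (ρ 0 = 0 ∧ ρ 1 = 1 ∧ ρ 2 = 2 ∧ ρ 3 = 3) ∨ (ρ 0 = 0 ∧ ρ 1 = 2 ∧ ρ 2 = 1 ∧ ρ 3 = 3) ∨
      (ρ 0 = 0 ∧ ρ 1 = 3 ∧ ρ 2 = 1 ∧ ρ 3 = 2) ∨ (ρ 0 = 1 ∧ ρ 1 = 2 ∧ ρ 2 = 0 ∧ ρ 3 = 3) ∨
      (ρ 0 = 1 ∧ ρ 1 = 3 ∧ ρ 2 = 0 ∧ ρ 3 = 2) ∨ (ρ 0 = 2 ∧ ρ 1 = 3 ∧ ρ 2 = 0 ∧ ρ 3 = 1) := by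
    have hdec : ∀ a < (4 : Fin 8), ∀ b < (4 : Fin 8), a < b → ∀ c < (4 : Fin 8), a ≠ c → b ≠ c →
        ∀ d < (4 : Fin 8), c < d → a ≠ d → b ≠ d →
        (a, b, c, d) ∈ [(0, 1, 2, 3), (0, 2, 1, 3), (0, 3, 1, 2), (1, 2, 0, 3), (1, 3, 0, 2),
          ((2 : Fin 8), (3 : Fin 8), (0 : Fin 8), (1 : Fin 8))] := by
      decide +kernel
    simpa using hdec _ a₀ _ a₁ h₀₁ _ a₂ n₀₂ n₁₂ _ a₃ h₂₃ n₀₃ n₁₃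
  have eq_of : ∀ τ : Equiv.Perm (Fin 8), ρ 0 = τ 0 → ρ 1 = τ 1 → ρ 2 = τ 2 → ρ 3 = τ 3 →
      4 = τ 4 → 5 = τ 5 → 6 = τ 6 → 7 = τ 7 → ρ = τ := by
    intro τ t₀ t₁ t₂ t₃ t₄ t₅ t₆ t₇
    apply Equiv.ext
    intro i
    fin_cases i
    · exact t₀
    · exact t₁
    · exact t₂
    · exact t₃
    · exact (h 4 (by decide)).trans t₄
    · exact (h 5 (by decide)).trans t₅
    · exact (h 6 (by decide)).trans t₆
    · exact (h 7 (by decide)).trans t₇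
  simp only [shuffles22, Finset.mem_insert, Finset.mem_singleton]
  apply key.imp _ (Or.imp _ (Or.imp _ (Or.imp _ (Or.imp _ _))))
  all_goals
    rintro ⟨h₀, h₁, h₂, h₃⟩
    apply eq_of <;> first | rw [h₀] | rw [h₁] | rw [h₂] | rw [h₃] | skip
    all_goals decide

/-- A sum over `(2,2,4)`-shuffles whose terms vanish unless the last block is sent to its image
under `b` reduces to six terms, when `b` is increasing on both blocks. -/
theorem sum_shuffles224 (b : Equiv.Perm (Fin 8))
    (hb : ∀ i j, (i < 4 ↔ j < 4) → (b i < b j ↔ i < j)) (F : Equiv.Perm (Fin 8) → ℝ)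
    (hF : ∀ σ : Equiv.Perm (Fin 8), σ 4 < σ 5 → σ 5 < σ 6 → σ 6 < σ 7 → F σ ≠ 0 →
      ∀ i, 4 ≤ i → σ i = b i) :
    ∑ σ ∈ Finset.univ.filter (fun σ : Equiv.Perm (Fin 8) =>
      σ 0 < σ 1 ∧ σ 2 < σ 3 ∧ σ 4 < σ 5 ∧ σ 5 < σ 6 ∧ σ 6 < σ 7), F σ =
      ∑ ρ ∈ shuffles22, F (b * ρ) := by
  rw [← Finset.sum_image (f := F) (s := shuffles22) (g := fun ρ => b * ρ)
    (fun _ _ _ _ h => mul_left_cancel h)]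
  symm
  apply Finset.sum_subset
  · intro σ hσ
    obtain ⟨ρ, hρ, rfl⟩ := Finset.mem_image.mp hσ
    have key : ∀ ρ ∈ shuffles22, ρ 0 < ρ 1 ∧ ρ 2 < ρ 3 ∧ ρ 0 < 4 ∧ ρ 1 < 4 ∧ ρ 2 < 4 ∧ ρ 3 < 4 ∧
        ρ 4 = 4 ∧ ρ 5 = 5 ∧ ρ 6 = 6 ∧ ρ 7 = 7 := by
      simp only [shuffles22, Finset.forall_mem_insert, Finset.mem_singleton, forall_eq]
      decide
    obtain ⟨r₀₁, r₂₃, r₀, r₁, r₂, r₃, r₄, r₅, r₆, r₇⟩ := key ρ hρ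
    simp only [Finset.mem_filter, Finset.mem_univ, true_and, Equiv.Perm.mul_apply, r₄, r₅, r₆, r₇]
    exact ⟨(hb _ _ (iff_of_true r₀ r₁)).mpr r₀₁, (hb _ _ (iff_of_true r₂ r₃)).mpr r₂₃,
      (hb _ _ (by decide)).mpr (by decide), (hb _ _ (by decide)).mpr (by decide),
      (hb _ _ (by decide)).mpr (by decide)⟩
  · intro σ hσ hn
    by_contra hne
    obtain ⟨h₀₁, h₂₃, h₄₅, h₅₆, h₆₇⟩ := (Finset.mem_filter.mp hσ).2
    have hfix : ∀ i, 4 ≤ i → (b⁻¹ * σ) i = i := fun i hi => by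
      rw [Equiv.Perm.mul_apply, hF σ h₄₅ h₅₆ h₆₇ hne i hi]
      exact b.symm_apply_apply i
    have hlt : ∀ i < 4, (b⁻¹ * σ) i < 4 := by
      intro i hi
      by_contra hc
      have := (b⁻¹ * σ).injective (hfix _ (not_lt.mp hc))
      rw [this] at hc
      exact hc hi
    have hinv : ∀ i, b ((b⁻¹ * σ) i) = σ i := fun i => by simp
    refine hn (Finset.mem_image.mpr ⟨b⁻¹ * σ, mem_shuffles22 hfix ?_ ?_, by simp⟩)
    · rw [← hb _ _ (iff_of_true (hlt 0 (by decide)) (hlt 1 (by decide))), hinv, hinv]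
      exact h₀₁
    · rw [← hb _ _ (iff_of_true (hlt 2 (by decide)) (hlt 3 (by decide))), hinv, hinv]
      exact h₂₃

theorem det_coordM_eq_zero {x : Fin 4 → H} {m : Fin 4} (h : x m = 0) : (coordM x).det = 0 := by
  apply Matrix.det_eq_zero_of_row_eq_zero m
  intro j
  fin_cases j <;> simp [coordM, h] <;> rfl

theorem det_coordM_basis : (coordM ![1, qi, qj, qk]).det = 1 := by
  rw [← Matrix.det_one (n := Fin 4) (R := ℝ)]
  congr 1
  ext i j
  fin_cases i <;> fin_cases j <;> simp [coordM, qi, qj, qk] <;> rfl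

theorem f_fst_eq_zero : ∀ {i : Fin 8}, 4 ≤ i → (f i).1 = 0 := by
  intro i hi
  fin_cases i <;> first | rfl | exact absurd hi (by decide)

theorem f_snd_eq_zero : ∀ {i : Fin 8}, i < 4 → (f i).2 = 0 := by
  intro i hi
  fin_cases i <;> first | rfl | exact absurd hi (by decide)

theorem wedge224_Om04 {ω : (H × H) → (H × H) → ℝ} :
    wedge224 ω ω Om04 = 2 * (ω (f 0) (f 1) * ω (f 2) (f 3) - ω (f 0) (f 2) * ω (f 1) (f 3) +
      ω (f 0) (f 3) * ω (f 1) (f 2)) := by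
  have hA : Om04 ![f 4, f 5, f 6, f 7] = 1 := by
    rw [← det_coordM_basis, Om04]
    congr 2
    ext1 m
    fin_cases m <;> rfl
  unfold wedge224
  rw [sum_shuffles224 1 (fun _ _ _ => Iff.rfl), sum_shuffles22]
  · simp [hA, Equiv.Perm.sign_mul, Equiv.swap_apply_def]
    ring
  · intro σ h₄₅ h₅₆ h₆₇ hne i hi
    have h₄ : 4 ≤ σ 4 := by
      by_contra hc
      refine hne (mul_eq_zero_of_right _ (det_coordM_eq_zero (m := 0) ?_))
      exact f_snd_eq_zero (not_le.mp hc)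
    have : σ 4 = 4 ∧ σ 5 = 5 ∧ σ 6 = 6 ∧ σ 7 = 7 := by omega
    obtain ⟨_, _, _, _⟩ := this
    fin_cases i <;> first | assumption | exact absurd hi (by decide)

theorem wedge224_Om40 {ω : (H × H) → (H × H) → ℝ} :
    wedge224 ω ω Om40 = 2 * (ω (f 4) (f 5) * ω (f 6) (f 7) - ω (f 4) (f 6) * ω (f 5) (f 7) +
      ω (f 4) (f 7) * ω (f 5) (f 6)) := by
  have hA : Om40 ![f 0, f 1, f 2, f 3] = 1 := by
    rw [← det_coordM_basis, Om40]
    congr 2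
    ext1 m
    fin_cases m <;> rfl
  unfold wedge224
  rw [sum_shuffles224 (Equiv.addRight 4) (by decide), sum_shuffles22]
  · have hs : Equiv.Perm.sign (Equiv.addRight (4 : Fin 8)) = 1 := by decide
    simp [hA, hs, Equiv.Perm.sign_mul, Equiv.swap_apply_def]
    ring
  · intro σ h₄₅ h₅₆ h₆₇ hne i hi
    have h₇ : σ 7 < 4 := by
      by_contra hc
      refine hne (mul_eq_zero_of_right _ (det_coordM_eq_zero (m := 3) ?_))
      exact f_fst_eq_zero (not_lt.mp hc)
    have : σ 4 = 0 ∧ σ 5 = 1 ∧ σ 6 = 2 ∧ σ 7 = 3 := by omega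
    obtain ⟨_, _, _, _⟩ := this
    fin_cases i <;> first | assumption | exact absurd hi (by decide)

theorem re_one_H : (1 : H).re = 1 := rfl

theorem imI_one_H : (1 : H).imI = 0 := rfl

theorem imJ_one_H : (1 : H).imJ = 0 := rfl

theorem imK_one_H : (1 : H).imK = 0 := rfl

theorem re_qi : qi.re = 0 := rfl

theorem imI_qi : qi.imI = 1 := rfl

theorem imJ_qi : qi.imJ = 0 := rfl

theorem imK_qi : qi.imK = 0 := rfl

theorem re_qj : qj.re = 0 := rfl

theorem imI_qj : qj.imI = 0 := rfl

theorem imJ_qj : qj.imJ = 1 := rfl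

theorem imK_qj : qj.imK = 0 := rfl

theorem re_qk : qk.re = 0 := rfl

theorem imI_qk : qk.imI = 0 := rfl

theorem imJ_qk : qk.imJ = 0 := rfl

theorem imK_qk : qk.imK = 1 := rfl

theorem sdH_zero (a b : H) : sdH 0 a b =
    2 * (a.imI * b.re - a.re * b.imI + a.imK * b.imJ - a.imJ * b.imK) := by
  simp only [sdH, Matrix.cons_val, Quaternion.imI_sub, Quaternion.imI_mul, Quaternion.re_star,
    Quaternion.imI_star, Quaternion.imJ_star, Quaternion.imK_star]
  ring

theorem sdH_one (a b : H) : sdH 1 a b =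
    2 * (a.imJ * b.re - a.re * b.imJ + a.imI * b.imK - a.imK * b.imI) := by
  simp only [sdH, Matrix.cons_val, Quaternion.imJ_sub, Quaternion.imJ_mul, Quaternion.re_star,
    Quaternion.imI_star, Quaternion.imJ_star, Quaternion.imK_star]
  ring

theorem sdH_two (a b : H) : sdH 2 a b =
    2 * (a.imK * b.re - a.re * b.imK + a.imJ * b.imI - a.imI * b.imJ) := by
  simp only [sdH, Matrix.cons_val, Quaternion.imK_sub, Quaternion.imK_mul, Quaternion.re_star,
    Quaternion.imI_star, Quaternion.imJ_star, Quaternion.imK_star]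
  ring

theorem innerH2_eq (a b : H → H → ℝ) :
    innerH2 a b = a 1 qi * b 1 qi + a 1 qj * b 1 qj + a 1 qk * b 1 qk +
      a qi qj * b qi qj + a qi qk * b qi qk + a qj qk * b qj qk := by
  have h₀ : Finset.Ioi (0 : Fin 4) = {1, 2, 3} := by decide
  have h₁ : Finset.Ioi (1 : Fin 4) = {2, 3} := by decide
  have h₂ : Finset.Ioi (2 : Fin 4) = {3} := by decide
  have h₃ : Finset.Ioi (3 : Fin 4) = ∅ := by decide
  simp [innerH2, Fin.sum_univ_four, h₀, h₁, h₂, h₃, e]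
  ring

/-- The difference of the squared norms of the self-dual and anti-self-dual parts is twice the
Pfaffian. -/
theorem innerH2_sdProj_sub (τ : H → H → ℝ) :
    innerH2 (sdProj τ) (sdProj τ) -
        innerH2 (fun u v => τ u v - sdProj τ u v) (fun u v => τ u v - sdProj τ u v) =
      2 * (τ 1 qi * τ qj qk - τ 1 qj * τ qi qk + τ 1 qk * τ qi qj) := by
  simp only [innerH2_eq, sdProj, Fin.sum_univ_three]
  simp only [sdH_zero, sdH_one, sdH_two, re_one_H, imI_one_H, imJ_one_H, imK_one_H,
    re_qi, imI_qi, imJ_qi, imK_qi, re_qj, imI_qj, imJ_qj, imK_qj,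
    re_qk, imI_qk, imJ_qk, imK_qk]
  ring

theorem innerH2_restrict_add_le_formInner (ω : (H × H) → (H × H) → ℝ) :
    innerH2 (fun x x' => ω (x, 0) (x', 0)) (fun x x' => ω (x, 0) (x', 0)) +
      innerH2 (fun y y' => ω (0, y) (0, y')) (fun y y' => ω (0, y) (0, y')) ≤ formInner ω ω := by
  have h₀ : Finset.Ioi (0 : Fin 8) = {1, 2, 3, 4, 5, 6, 7} := by decide
  have h₁ : Finset.Ioi (1 : Fin 8) = {2, 3, 4, 5, 6, 7} := by decide
  have h₂ : Finset.Ioi (2 : Fin 8) = {3, 4, 5, 6, 7} := by decide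
  have h₃ : Finset.Ioi (3 : Fin 8) = {4, 5, 6, 7} := by decide
  have h₄ : Finset.Ioi (4 : Fin 8) = {5, 6, 7} := by decide
  have h₅ : Finset.Ioi (5 : Fin 8) = {6, 7} := by decide
  have h₆ : Finset.Ioi (6 : Fin 8) = {7} := by decide
  have h₇ : Finset.Ioi (7 : Fin 8) = ∅ := by decide
  have hmixed : 0 ≤ ∑ p : Fin 4, ∑ q : Fin 4, ω (e p, 0) (0, e q) * ω (e p, 0) (0, e q) :=
    Finset.sum_nonneg fun _ _ => Finset.sum_nonneg fun _ _ => mul_self_nonneg _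
  simp [Fin.sum_univ_four, e] at hmixed
  simp [innerH2_eq, formInner, Fin.sum_univ_eight, h₀, h₁, h₂, h₃, h₄, h₅, h₆, h₇, f]
  linarith

theorem two_mul_abs_pfaffian_le (τ : H → H → ℝ) :
    |2 * (τ 1 qi * τ qj qk - τ 1 qj * τ qi qk + τ 1 qk * τ qi qj)| ≤ innerH2 τ τ := by
  rw [innerH2_eq, abs_le]
  constructor <;>
  nlinarith [sq_nonneg (τ 1 qi + τ qj qk), sq_nonneg (τ 1 qi - τ qj qk),
    sq_nonneg (τ 1 qj + τ qi qk), sq_nonneg (τ 1 qj - τ qi qk),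
    sq_nonneg (τ 1 qk + τ qi qj), sq_nonneg (τ 1 qk - τ qi qj)]

theorem innerH2_self_nonneg (τ : H → H → ℝ) : 0 ≤ innerH2 τ τ :=
  Finset.sum_nonneg fun _ _ => Finset.sum_nonneg fun _ _ => mul_self_nonneg _

/-- for any alternating 2-form ω on ℍ ⊕ ℍ, with ω₂₀, ω₀₂ its restrictions
to the two factors, −(ω∧ω∧Ω⁴⁰)(f₀,…,f₇) = |ω₀₂⁻|² − |ω₀₂⁺|² and
(ω∧ω∧Ω⁰⁴)(f₀,…,f₇) = |ω₂₀⁺|² − |ω₂₀⁻|²; in particular both are ≤ |ω|². -/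
theorem stmt13 : ∀ ω : (H × H) → (H × H) → ℝ, IsAlt2 ω →
    (-(wedge224 ω ω Om40) =
        innerH2 (fun y y' => ω (0, y) (0, y') - sdProj (fun y y' => ω (0, y) (0, y')) y y')
                (fun y y' => ω (0, y) (0, y') - sdProj (fun y y' => ω (0, y) (0, y')) y y')
          - innerH2 (sdProj fun y y' => ω (0, y) (0, y'))
                    (sdProj fun y y' => ω (0, y) (0, y'))) ∧
    (wedge224 ω ω Om04 =
        innerH2 (sdProj fun x x' => ω (x, 0) (x', 0))
                (sdProj fun x x' => ω (x, 0) (x', 0))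
          - innerH2 (fun x x' => ω (x, 0) (x', 0) - sdProj (fun x x' => ω (x, 0) (x', 0)) x x')
                    (fun x x' => ω (x, 0) (x', 0) - sdProj (fun x x' => ω (x, 0) (x', 0)) x x')) ∧
    -(wedge224 ω ω Om40) ≤ formInner ω ω ∧
    wedge224 ω ω Om04 ≤ formInner ω ω := by
  intro ω _
  have h₄₀ : wedge224 ω ω Om40 = _ := wedge224_Om40
  have h₀₄ : wedge224 ω ω Om04 = _ := wedge224_Om04
  have hy := innerH2_sdProj_sub fun y y' => ω (0, y) (0, y')
  have hx := innerH2_sdProj_sub fun x x' => ω (x, 0) (x', 0)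
  have hpy := abs_le.mp (two_mul_abs_pfaffian_le fun y y' => ω (0, y) (0, y'))
  have hpx := abs_le.mp (two_mul_abs_pfaffian_le fun x x' => ω (x, 0) (x', 0))
  have ny := innerH2_self_nonneg fun y y' => ω (0, y) (0, y')
  have nx := innerH2_self_nonneg fun x x' => ω (x, 0) (x', 0)
  have hle := innerH2_restrict_add_le_formInner ω
  simp only [f, Matrix.cons_val] at h₄₀ h₀₄
  exact ⟨by linarith, by linarith, by linarith, by linarith⟩
end
end

section
/- For every ε ∈ (0,1) and every alternating 2-form ω on ℍ ⊕ ℍ, the pointwise inequality underlying the decomposition Ω_ε = Ω_{1,ε} + Ω_{2,ε} holds: −(ω ∧ ω ∧ Ω_{2,ε})(f₀,…,f₇) ≤ |ω|², where Ω_{2,ε} = (1−ε) Ω⁴⁰ − ε(1−ε) Ω⁰⁴. -/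
noncomputable section

lemma f_fst_eq_zero_s14 {a : Fin 8} (ha : 4 ≤ a) : (f a).1 = 0 := by
  fin_cases a <;> first | rfl | exact absurd ha (by decide)

lemma f_snd_eq_zero_s14 {a : Fin 8} (ha : a < 4) : (f a).2 = 0 := by
  fin_cases a <;> first | rfl | exact absurd ha (by decide)

lemma Om40_eq_zero {u : Fin 4 → H × H} (m : Fin 4) (h : (u m).1 = 0) : Om40 u = 0 := by
  refine Matrix.det_eq_zero_of_row_eq_zero m fun j => ?_
  fin_cases j <;> simp [coordM, h] <;> rfl

lemma Om04_eq_zero {u : Fin 4 → H × H} (m : Fin 4) (h : (u m).2 = 0) : Om04 u = 0 := by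
  refine Matrix.det_eq_zero_of_row_eq_zero m fun j => ?_
  fin_cases j <;> simp [coordM, h] <;> rfl

lemma coordM_basis : coordM ![1, qi, qj, qk] = 1 := by
  ext m n
  fin_cases m <;> fin_cases n <;> simp [coordM, qi, qj, qk] <;> rfl

lemma Om40_first_block : Om40 ![f 0, f 1, f 2, f 3] = 1 := by
  have h : (fun m => ((![f 0, f 1, f 2, f 3] : Fin 4 → H × H) m).1) = ![1, qi, qj, qk] := by
    funext m; fin_cases m <;> rfl
  rw [Om40, h, coordM_basis, Matrix.det_one]

lemma Om04_second_block : Om04 ![f 4, f 5, f 6, f 7] = 1 := by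
  have h : (fun m => ((![f 4, f 5, f 6, f 7] : Fin 4 → H × H) m).2) = ![1, qi, qj, qk] := by
    funext m; fin_cases m <;> rfl
  rw [Om04, h, coordM_basis, Matrix.det_one]

/-- `(2,2,4)`-shuffles of `Fin 8`. -/
def IsShuffle224 (σ : Equiv.Perm (Fin 8)) : Prop :=
  σ 0 < σ 1 ∧ σ 2 < σ 3 ∧ σ 4 < σ 5 ∧ σ 5 < σ 6 ∧ σ 6 < σ 7

/-- The last four values of `σ` lie in a single `ℍ`-summand. -/
def LastInBlock (σ : Equiv.Perm (Fin 8)) : Prop := σ 7 < 4 ∨ 4 ≤ σ 4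

lemma form_eq_zero_of_not_lastInBlock (s t : ℝ) {σ : Equiv.Perm (Fin 8)}
    (h : ¬ LastInBlock σ) :
    s * Om40 ![f (σ 4), f (σ 5), f (σ 6), f (σ 7)]
      - t * Om04 ![f (σ 4), f (σ 5), f (σ 6), f (σ 7)] = 0 := by
  obtain ⟨h7, h4⟩ := not_or.1 h
  rw [Om40_eq_zero 3 (f_fst_eq_zero_s14 (not_lt.1 h7)), Om04_eq_zero 0 (f_snd_eq_zero_s14 (not_le.1 h4))]
  simp

lemma abs_form_le_one {s t : ℝ} (hs : |s| ≤ 1) (ht : |t| ≤ 1) {σ : Equiv.Perm (Fin 8)}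
    (hσ : IsShuffle224 σ) (h : LastInBlock σ) :
    |s * Om40 ![f (σ 4), f (σ 5), f (σ 6), f (σ 7)]
      - t * Om04 ![f (σ 4), f (σ 5), f (σ 6), f (σ 7)]| ≤ 1 := by
  obtain ⟨-, -, h45, h56, h67⟩ := hσ
  rcases h with h | h
  · have h4 : σ 4 = 0 := by omega
    have h5 : σ 5 = 1 := by omega
    have h6 : σ 6 = 2 := by omega
    have h7 : σ 7 = 3 := by omega
    rw [h4, h5, h6, h7, Om40_first_block, Om04_eq_zero 0 (f_snd_eq_zero_s14 (a := 0) (by decide))]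
    simpa using hs
  · have h4 : σ 4 = 4 := by omega
    have h5 : σ 5 = 5 := by omega
    have h6 : σ 6 = 6 := by omega
    have h7 : σ 7 = 7 := by omega
    rw [h4, h5, h6, h7, Om04_second_block, Om40_eq_zero 0 (f_fst_eq_zero_s14 (a := 4) (by decide))]
    simpa using ht

lemma perm_ext_of_block {σ τ : Equiv.Perm (Fin 8)}
    (hσ : IsShuffle224 σ) (hσb : LastInBlock σ) (hτ : IsShuffle224 τ) (hτb : LastInBlock τ)
    (h : (σ 0 = τ 0 ∧ σ 1 = τ 1) ∨ (σ 2 = τ 2 ∧ σ 3 = τ 3)) : σ = τ := by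
  have key : ∀ ρ : Equiv.Perm (Fin 8), IsShuffle224 ρ → LastInBlock ρ →
      ((ρ 4 = 0 ∧ ρ 5 = 1 ∧ ρ 6 = 2 ∧ ρ 7 = 3 ∧ 4 ≤ ρ 0 ∧ 4 ≤ ρ 1 ∧ 4 ≤ ρ 2 ∧ 4 ≤ ρ 3) ∨
        (ρ 4 = 4 ∧ ρ 5 = 5 ∧ ρ 6 = 6 ∧ ρ 7 = 7 ∧ ρ 0 < 4 ∧ ρ 1 < 4 ∧ ρ 2 < 4 ∧ ρ 3 < 4)) ∧
      ρ 0 ≠ ρ 2 ∧ ρ 0 ≠ ρ 3 ∧ ρ 1 ≠ ρ 2 ∧ ρ 1 ≠ ρ 3 := by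
    rintro ρ ⟨h01, h23, h45, h56, h67⟩ hb
    have ne : ∀ i j : Fin 8, i ≠ j → ρ i ≠ ρ j := fun i j hij => ρ.injective.ne hij
    have n : ∀ i : Fin 8, i < 4 → ρ i ≠ ρ 4 ∧ ρ i ≠ ρ 5 ∧ ρ i ≠ ρ 6 ∧ ρ i ≠ ρ 7 := fun i hi =>
      ⟨ne _ _ (by omega), ne _ _ (by omega), ne _ _ (by omega), ne _ _ (by omega)⟩
    have n0 := n 0 (by decide)
    have n1 := n 1 (by decide)
    have n2 := n 2 (by decide)
    have n3 := n 3 (by decide)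
    refine ⟨?_, ne _ _ (by decide), ne _ _ (by decide), ne _ _ (by decide), ne _ _ (by decide)⟩
    rcases hb with hb | hb
    · have h4 : ρ 4 = 0 := by omega
      have h5 : ρ 5 = 1 := by omega
      have h6 : ρ 6 = 2 := by omega
      have h7 : ρ 7 = 3 := by omega
      rw [h4, h5, h6, h7] at n0 n1 n2 n3
      refine Or.inl ⟨h4, h5, h6, h7, ?_, ?_, ?_, ?_⟩ <;> omega
    · have h4 : ρ 4 = 4 := by omega
      have h5 : ρ 5 = 5 := by omega
      have h6 : ρ 6 = 6 := by omega
      have h7 : ρ 7 = 7 := by omega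
      rw [h4, h5, h6, h7] at n0 n1 n2 n3
      refine Or.inr ⟨h4, h5, h6, h7, ?_, ?_, ?_, ?_⟩ <;> omega
  have kσ := key σ hσ hσb
  have kτ := key τ hτ hτb
  obtain ⟨s01, s23, -⟩ := hσ
  obtain ⟨t01, t23, -⟩ := hτ
  clear key hσb hτb
  have main : σ 0 = τ 0 ∧ σ 1 = τ 1 ∧ σ 2 = τ 2 ∧ σ 3 = τ 3 ∧
      σ 4 = τ 4 ∧ σ 5 = τ 5 ∧ σ 6 = τ 6 ∧ σ 7 = τ 7 := by
    generalize σ 0 = s0, σ 1 = s1, σ 2 = s2, σ 3 = s3, σ 4 = s4, σ 5 = s5, σ 6 = s6, σ 7 = s7,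
      τ 0 = t0, τ 1 = t1, τ 2 = t2, τ 3 = t3, τ 4 = t4, τ 5 = t5, τ 6 = t6, τ 7 = t7 at *
    rcases kσ with ⟨⟨rfl, rfl, rfl, rfl, ks⟩ | ⟨rfl, rfl, rfl, rfl, ks⟩, ns⟩ <;>
    rcases kτ with ⟨⟨rfl, rfl, rfl, rfl, kt⟩ | ⟨rfl, rfl, rfl, rfl, kt⟩, nt⟩ <;>
    rcases h with ⟨rfl, rfl⟩ | ⟨rfl, rfl⟩ <;> first | (exfalso; omega) | skip
    all_goals
      refine ⟨?_, ?_, ?_, ?_, rfl, rfl, rfl, rfl⟩ <;> first | rfl | omega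
  obtain ⟨m0, m1, m2, m3, m4, m5, m6, m7⟩ := main
  ext i
  fin_cases i <;> simp [*]

lemma sum_sq_le_formInner (ω : (H × H) → (H × H) → ℝ) (S : Finset (Equiv.Perm (Fin 8)))
    (i j : Fin 8) (hlt : ∀ σ ∈ S, σ i < σ j)
    (hinj : ∀ σ ∈ S, ∀ τ ∈ S, σ i = τ i → σ j = τ j → σ = τ) :
    ∑ σ ∈ S, ω (f (σ i)) (f (σ j)) ^ 2 ≤ formInner ω ω := by
  let g : Equiv.Perm (Fin 8) → (_ : Fin 8) × Fin 8 := fun σ => ⟨σ i, σ j⟩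
  have hg : Set.InjOn g S := fun σ hσ τ hτ h => by
    obtain ⟨h1, h2⟩ := Sigma.mk.inj_iff.1 h
    exact hinj σ hσ τ hτ h1 (eq_of_heq h2)
  rw [formInner, Finset.sum_sigma']
  calc ∑ σ ∈ S, ω (f (σ i)) (f (σ j)) ^ 2
      = ∑ p ∈ S.image g, ω (f p.1) (f p.2) * ω (f p.1) (f p.2) := by
        rw [Finset.sum_image hg]
        exact Finset.sum_congr rfl fun σ _ => sq _
    _ ≤ _ := by
        refine Finset.sum_le_sum_of_subset_of_nonneg ?_ fun p _ _ => mul_self_nonneg _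
        intro p hp
        obtain ⟨σ, hσ, rfl⟩ := Finset.mem_image.1 hp
        simpa [g] using hlt σ hσ

lemma neg_sign_mul_le {σ : Equiv.Perm (Fin 8)} {a b c : ℝ} (hc : |c| ≤ 1) :
    -(((Equiv.Perm.sign σ : ℤ) : ℝ) * a * b * c) ≤ (a ^ 2 + b ^ 2) / 2 := by
  have hsign : |((Equiv.Perm.sign σ : ℤ) : ℝ)| = 1 := by
    rcases Int.units_eq_one_or (Equiv.Perm.sign σ) with h | h <;> simp [h]
  calc -(((Equiv.Perm.sign σ : ℤ) : ℝ) * a * b * c)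
      ≤ |((Equiv.Perm.sign σ : ℤ) : ℝ) * a * b * c| := neg_le_abs _
    _ = |a| * |b| * |c| := by rw [abs_mul, abs_mul, abs_mul, hsign, one_mul]
    _ ≤ |a| * |b| := mul_le_of_le_one_right (by positivity) hc
    _ ≤ (a ^ 2 + b ^ 2) / 2 := by
        nlinarith [sq_nonneg (|a| - |b|), sq_abs a, sq_abs b]

/-- The bound holds for all combinations of the two volume forms with coefficients in
`[-1, 1]`, and does not use that `ω` is alternating. -/
lemma neg_wedge224_le_formInner {s t : ℝ} (hs : |s| ≤ 1) (ht : |t| ≤ 1)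
    (ω : (H × H) → (H × H) → ℝ) :
    -(wedge224 ω ω fun u => s * Om40 u - t * Om04 u) ≤ formInner ω ω := by
  classical
  let S := Finset.univ.filter fun σ => IsShuffle224 σ ∧ LastInBlock σ
  have hS : ∀ σ ∈ S, IsShuffle224 σ ∧ LastInBlock σ := fun σ hσ => (Finset.mem_filter.1 hσ).2
  have h1 := sum_sq_le_formInner ω S 0 1 (fun σ hσ => (hS σ hσ).1.1)
    fun σ hσ τ hτ ha hb => perm_ext_of_block (hS σ hσ).1 (hS σ hσ).2 (hS τ hτ).1 (hS τ hτ).2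
      (Or.inl ⟨ha, hb⟩)
  have h2 := sum_sq_le_formInner ω S 2 3 (fun σ hσ => (hS σ hσ).1.2.1)
    fun σ hσ τ hτ ha hb => perm_ext_of_block (hS σ hσ).1 (hS σ hσ).2 (hS τ hτ).1 (hS τ hτ).2
      (Or.inr ⟨ha, hb⟩)
  have hbound : -(wedge224 ω ω fun u => s * Om40 u - t * Om04 u) ≤
      ∑ σ ∈ S, (ω (f (σ 0)) (f (σ 1)) ^ 2 + ω (f (σ 2)) (f (σ 3)) ^ 2) / 2 := by
    rw [wedge224, ← Finset.sum_neg_distrib, ← Finset.sum_subset (s₁ := S)]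
    · exact Finset.sum_le_sum fun σ hσ =>
        neg_sign_mul_le (abs_form_le_one hs ht (hS σ hσ).1 (hS σ hσ).2)
    · exact fun σ hσ => Finset.mem_filter.2 ⟨Finset.mem_univ _, (hS σ hσ).1⟩
    · intro σ hσ hσS
      have hb : ¬ LastInBlock σ := fun hb =>
        hσS (Finset.mem_filter.2 ⟨Finset.mem_univ _, (Finset.mem_filter.1 hσ).2, hb⟩)
      simp only [form_eq_zero_of_not_lastInBlock s t hb, mul_zero, neg_zero]
  rw [← Finset.sum_div, Finset.sum_add_distrib] at hbound
  linarith

/-- for every ε ∈ (0,1) and every alternating 2-form ω on ℍ ⊕ ℍ,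
−(ω ∧ ω ∧ Ω_{2,ε})(f₀,…,f₇) ≤ |ω|², where Ω_{2,ε} = (1−ε)Ω⁴⁰ − ε(1−ε)Ω⁰⁴. -/
theorem stmt14 : ∀ ε : ℝ, ε ∈ Set.Ioo (0 : ℝ) 1 →
    ∀ ω : (H × H) → (H × H) → ℝ, IsAlt2 ω →
      -(wedge224 ω ω (fun u => (1 - ε) * Om40 u - ε * (1 - ε) * Om04 u))
        ≤ formInner ω ω := by
  rintro ε ⟨h0, h1⟩ ω -
  refine neg_wedge224_le_formInner ?_ ?_ ω <;> rw [abs_le] <;> constructor <;> nlinarith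
end
end
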